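/- arXiv:2605.14013 — 5 statements merged into one kernel-verified Lean document; each statement's English description precedes it below -/
import Mathlib

section
/- Let X be a real n×n skew-symmetric matrix (Xᵀ = −X) with rank(X) = 2r. Then there exist an orthogonal matrix Q ∈ O_n(ℝ) and an invertible skew-symmetric matrix Ω ∈ ℝ^{2r×2r} such that for every invertible real n×n matrix A the following are equivalent: (i) A X Aᵀ = X; (ii) writing C := Qᵀ A Q in block form with C₁₁ the (2r)×(2r) block on the first 2r rows and columns, one has C₁₁ Ω C₁₁ᵀ = Ω and C₂₁ = 0. -/
open Matrix

/-- The rank of a square matrix is at most its size. -/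
theorem rank_eq_le_size {n m : ℕ} (X : Matrix (Fin n) (Fin n) ℝ) (h : X.rank = m) : m ≤ n := by
  rw [← h]; simpa using X.rank_le_card_height

/-- The `n × m` matrix of the inclusion of the first `m` coordinates. -/
def coordInclusion {m n : ℕ} (h : m ≤ n) : Matrix (Fin n) (Fin m) ℝ :=
  (1 : Matrix (Fin n) (Fin n) ℝ).submatrix id (Fin.castLE h)

theorem mul_coordInclusion {m n k : ℕ} (h : m ≤ n) (M : Matrix (Fin k) (Fin n) ℝ) :
    M * coordInclusion h = M.submatrix id (Fin.castLE h) := by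
  ext i j
  simp [coordInclusion, Matrix.mul_apply, Matrix.one_apply]

theorem coordInclusion_transpose_mul {m n k : ℕ} (h : m ≤ n) (M : Matrix (Fin n) (Fin k) ℝ) :
    (coordInclusion h)ᵀ * M = M.submatrix (Fin.castLE h) id := by
  ext i j
  simp [coordInclusion, Matrix.mul_apply, Matrix.one_apply]

theorem coordInclusion_mul_apply_of_le {m n k : ℕ} (h : m ≤ n) (M : Matrix (Fin m) (Fin k) ℝ)
    (i : Fin n) (hi : m ≤ i) (j : Fin k) : (coordInclusion h * M) i j = 0 := by
  rw [Matrix.mul_apply]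
  refine Finset.sum_eq_zero fun l _ => ?_
  have hne : i ≠ Fin.castLE h l := by
    intro hil
    have := congrArg Fin.val hil
    have := l.2
    simp at *
    omega
  simp [coordInclusion, hne]

theorem coordInclusion_mul_castLE {m n k : ℕ} (h : m ≤ n) (M : Matrix (Fin m) (Fin k) ℝ)
    (i : Fin m) (j : Fin k) : (coordInclusion h * M) (Fin.castLE h i) j = M i j := by
  simp [coordInclusion, Matrix.mul_apply, Matrix.one_apply]

/-- A matrix whose rows vanish from index `m` on is recovered from its first `m` rows. -/
theorem coordInclusion_mul_transpose_mul {m n k : ℕ} (h : m ≤ n) (M : Matrix (Fin n) (Fin k) ℝ)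
    (hM : ∀ (i : Fin n) (j : Fin k), m ≤ i → M i j = 0) :
    coordInclusion h * ((coordInclusion h)ᵀ * M) = M := by
  ext i j
  rcases lt_or_ge (i : ℕ) m with hi | hi
  · have hentry := coordInclusion_mul_castLE h ((coordInclusion h)ᵀ * M) ⟨i, hi⟩ j
    rw [coordInclusion_transpose_mul] at hentry ⊢
    exact hentry
  · rw [coordInclusion_mul_apply_of_le h _ i hi, hM i j hi]

theorem coordInclusion_transpose_mul_self {m n : ℕ} (h : m ≤ n) :
    (coordInclusion h)ᵀ * coordInclusion h = 1 := by
  rw [coordInclusion_transpose_mul]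
  ext i j
  simp [coordInclusion, Matrix.one_apply]

theorem transpose_mul_mul_coordInclusion {m n : ℕ} (h : m ≤ n) (M : Matrix (Fin n) (Fin n) ℝ) :
    (coordInclusion h)ᵀ * M * coordInclusion h =
      M.submatrix (Fin.castLE h) (Fin.castLE h) := by
  rw [mul_coordInclusion, coordInclusion_transpose_mul]
  rfl

theorem isUnit_of_rank_eq {m : ℕ} (M : Matrix (Fin m) (Fin m) ℝ) (h : M.rank = m) :
    IsUnit M := by
  rw [← Matrix.mulVec_surjective_iff_isUnit]
  have htop : LinearMap.range M.mulVecLin = ⊤ := by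
    apply Submodule.eq_top_of_finrank_eq
    rw [← Matrix.rank, h]
    simp
  exact LinearMap.range_eq_top.mp htop

/-- An orthogonal change of coordinates putting the column space of a real square matrix into the
span of the first `rank` coordinates. -/
theorem exists_orthogonal_transpose_mul_eq_zero {n m : ℕ} (X : Matrix (Fin n) (Fin n) ℝ)
    (hX : X.rank = m) :
    ∃ Q : Matrix (Fin n) (Fin n) ℝ, Qᵀ * Q = 1 ∧
      ∀ i j : Fin n, m ≤ i → (Qᵀ * X) i j = 0 := by
  let W : Submodule ℝ (EuclideanSpace ℝ (Fin n)) := LinearMap.range (Matrix.toEuclideanLin X)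
  have hW : Module.finrank ℝ W = m := by
    rw [← hX, Matrix.rank_eq_finrank_range_toLin X (EuclideanSpace.basisFun (Fin n) ℝ).toBasis
      (EuclideanSpace.basisFun (Fin n) ℝ).toBasis, ← Matrix.toEuclideanLin_eq_toLin_orthonormal]
  let b : OrthonormalBasis (Fin m) ℝ W := (stdOrthonormalBasis ℝ W).reindex (finCongr hW)
  let v : Fin n → EuclideanSpace ℝ (Fin n) := fun i => if h : (i : ℕ) < m then b ⟨i, h⟩ else 0
  have hv : Orthonormal ℝ ({i : Fin n | (i : ℕ) < m}.domRestrict v) := by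
    have hcomp := (b.orthonormal.comp_linearIsometry W.subtypeₗᵢ).comp
      (fun i : {i : Fin n | (i : ℕ) < m} => (⟨i.1, i.2⟩ : Fin m))
      (fun i j hij => Subtype.ext (Fin.ext (by simpa using hij)))
    convert hcomp using 1
    ext1 i
    have hi : ((i : Fin n) : ℕ) < m := i.2
    simp [v, Set.domRestrict_apply, hi]
  obtain ⟨c, hc⟩ := hv.exists_orthonormalBasis_extension_of_card_eq (by simp)
  have hperp : ∀ i : Fin n, m ≤ i → ∀ w ∈ W, inner ℝ (c i) w = 0 := by
    intro i hi w hw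
    have hsum := b.sum_repr ⟨w, hw⟩
    have hsum' : ∑ l, b.repr ⟨w, hw⟩ l • (b l : EuclideanSpace ℝ (Fin n)) = w := by
      simpa using congrArg Subtype.val hsum
    rw [← hsum', inner_sum]
    refine Finset.sum_eq_zero fun l _ => ?_
    have hl : (l : ℕ) < n := l.2.trans_le (hi.trans i.2.le)
    have hcl : c ⟨l, hl⟩ = b l := by
      rw [hc ⟨l, hl⟩ l.2]
      simp [v]
    have hne : i ≠ ⟨l, hl⟩ := by
      rintro rfl
      exact absurd l.2 (not_lt.mpr hi)
    rw [← hcl, inner_smul_right, c.orthonormal.2 hne, mul_zero]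
  refine ⟨Matrix.of fun i j => c j i, ?_, fun i j hi => ?_⟩
  · ext i j
    have hij := (orthonormal_iff_ite.mp c.orthonormal) i j
    rw [Matrix.one_apply, ← hij]
    simp [Matrix.mul_apply, PiLp.inner_apply, mul_comm]
  · have hij := hperp i hi (Matrix.toEuclideanLin X (EuclideanSpace.single j 1)) ⟨_, rfl⟩
    rw [← hij]
    simp [Matrix.mul_apply, PiLp.inner_apply, Matrix.toLpLin_apply, mul_comm]

theorem stabilizer_congruence_skew_real (n r : ℕ) (X : Matrix (Fin n) (Fin n) ℝ)
    (hskew : Xᵀ = -X) (hrank : X.rank = 2 * r) :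
    ∃ (Q : Matrix (Fin n) (Fin n) ℝ) (Om : Matrix (Fin (2 * r)) (Fin (2 * r)) ℝ),
      Qᵀ * Q = 1 ∧ Omᵀ = -Om ∧ IsUnit Om ∧
      ∀ A : Matrix (Fin n) (Fin n) ℝ, IsUnit A →
        (A * X * Aᵀ = X ↔
          ((Qᵀ * A * Q).submatrix (Fin.castLE (rank_eq_le_size X hrank))
              (Fin.castLE (rank_eq_le_size X hrank)) * Om *
            ((Qᵀ * A * Q).submatrix (Fin.castLE (rank_eq_le_size X hrank))
              (Fin.castLE (rank_eq_le_size X hrank)))ᵀ = Om ∧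
           ∀ i j : Fin n, 2 * r ≤ (i : ℕ) → (j : ℕ) < 2 * r → (Qᵀ * A * Q) i j = 0)) := by
  obtain ⟨Q, hQ, hrows⟩ := exists_orthogonal_transpose_mul_eq_zero X hrank
  have hQ' : Q * Qᵀ = 1 := mul_eq_one_comm.mp hQ
  have hle : 2 * r ≤ n := rank_eq_le_size X hrank
  let P := coordInclusion hle
  have hPP : Pᵀ * P = 1 := coordInclusion_transpose_mul_self hle
  have hPX : P * (Pᵀ * (Qᵀ * X)) = Qᵀ * X := coordInclusion_mul_transpose_mul hle _ hrows
  have hXP : X * Q * P * Pᵀ = X * Q := by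
    have := congrArg Matrix.transpose hPX
    simpa [Matrix.transpose_mul, hskew, Matrix.mul_assoc] using this
  let Om := Pᵀ * (Qᵀ * X * Q) * P
  have hX : X = Q * P * Om * (Q * P)ᵀ := by
    calc X = Q * Qᵀ * X * (Q * Qᵀ) := by simp [hQ']
      _ = Q * (Qᵀ * (X * Q)) * Qᵀ := by simp only [Matrix.mul_assoc]
      _ = Q * (Qᵀ * (X * Q * P * Pᵀ)) * Qᵀ := by rw [hXP]
      _ = Q * (Qᵀ * X) * Q * P * Pᵀ * Qᵀ := by simp only [Matrix.mul_assoc]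
      _ = Q * (P * (Pᵀ * (Qᵀ * X))) * Q * P * Pᵀ * Qᵀ := by rw [hPX]
      _ = _ := by simp only [Om, Matrix.mul_assoc, Matrix.transpose_mul]
  have hOm : IsUnit Om := by
    refine isUnit_of_rank_eq Om (le_antisymm (by simpa using Om.rank_le_card_height) ?_)
    calc 2 * r = (Q * P * Om * (Q * P)ᵀ).rank := by rw [← hX, hrank]
      _ ≤ (Q * P * Om).rank := Matrix.rank_mul_le_left _ _
      _ ≤ Om.rank := Matrix.rank_mul_le_right _ _
  refine ⟨Q, Om, hQ, by simp [Om, Matrix.transpose_mul, hskew, Matrix.mul_assoc], hOm,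
    fun A _ => ?_⟩
  set C := Qᵀ * A * Q with hC
  rw [← transpose_mul_mul_coordInclusion hle C]
  change _ ↔ (Pᵀ * C * P) * Om * (Pᵀ * C * P)ᵀ = Om ∧ _
  have hAQ : A * Q = Q * C := by
    rw [hC, Matrix.mul_assoc Qᵀ, ← Matrix.mul_assoc Q, hQ', Matrix.one_mul]
  have hAX : A * X * Aᵀ = Q * (C * P * Om * (C * P)ᵀ) * Qᵀ := by
    calc A * X * Aᵀ = (A * Q) * P * Om * Pᵀ * (A * Q)ᵀ := by
          conv_lhs => rw [hX]
          simp only [Matrix.mul_assoc, Matrix.transpose_mul]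
      _ = _ := by
          rw [hAQ]
          simp only [Matrix.mul_assoc, Matrix.transpose_mul]
  constructor
  · intro hstab
    have hCP : C * P * Om * (C * P)ᵀ = P * Om * Pᵀ := by
      have hconj := hAX.symm.trans (hstab.trans hX)
      calc C * P * Om * (C * P)ᵀ
          = Qᵀ * Q * (C * P * Om * (C * P)ᵀ) * (Qᵀ * Q) := by simp [hQ]
        _ = Qᵀ * (Q * (C * P * Om * (C * P)ᵀ) * Qᵀ) * Q := by simp only [Matrix.mul_assoc]
        _ = Qᵀ * (Q * P * Om * (Q * P)ᵀ) * Q := by rw [hconj]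
        _ = (Qᵀ * Q) * P * Om * Pᵀ * (Qᵀ * Q) := by
          simp only [Matrix.mul_assoc, Matrix.transpose_mul]
        _ = _ := by simp [hQ]
    have hright : C * P * (Om * (Pᵀ * C * P)ᵀ) = P * Om := by
      calc C * P * (Om * (Pᵀ * C * P)ᵀ) = C * P * Om * (C * P)ᵀ * P := by
            simp only [Matrix.mul_assoc, Matrix.transpose_mul, Matrix.transpose_transpose]
        _ = P * Om * (Pᵀ * P) := by rw [hCP, Matrix.mul_assoc]
        _ = _ := by rw [hPP, Matrix.mul_one]
    have hblock : (Pᵀ * C * P) * (Om * (Pᵀ * C * P)ᵀ) = Om := by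
      calc (Pᵀ * C * P) * (Om * (Pᵀ * C * P)ᵀ) = Pᵀ * (C * P * (Om * (Pᵀ * C * P)ᵀ)) := by
            simp only [Matrix.mul_assoc]
        _ = Om := by rw [hright, ← Matrix.mul_assoc, hPP, Matrix.one_mul]
    refine ⟨by rw [Matrix.mul_assoc, hblock], fun i j hi hj => ?_⟩
    have hunit : IsUnit (Om * (Pᵀ * C * P)ᵀ).det := by
      rw [← hblock, Matrix.isUnit_iff_isUnit_det, Matrix.det_mul] at hOm
      exact isUnit_of_mul_isUnit_right hOm
    have hsolve : C * P = P * (Om * (Om * (Pᵀ * C * P)ᵀ)⁻¹) := by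
      rw [← Matrix.mul_assoc, ← hright, Matrix.mul_nonsing_inv_cancel_right _ _ hunit]
    have hentry := congrFun (congrFun hsolve i) ⟨j, hj⟩
    rw [coordInclusion_mul_apply_of_le hle _ i hi, mul_coordInclusion] at hentry
    exact hentry
  · rintro ⟨hblock, hzero⟩
    have hCP : C * P = P * (Pᵀ * C * P) := by
      rw [Matrix.mul_assoc Pᵀ]
      refine (coordInclusion_mul_transpose_mul hle _ fun i j hi => ?_).symm
      rw [mul_coordInclusion]
      exact hzero i _ hi j.2
    rw [hAX, hCP]
    calc Q * (P * (Pᵀ * C * P) * Om * (P * (Pᵀ * C * P))ᵀ) * Qᵀ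
        = Q * P * ((Pᵀ * C * P) * Om * (Pᵀ * C * P)ᵀ) * (Q * P)ᵀ := by
          rw [Matrix.transpose_mul P, Matrix.transpose_mul Q]
          simp only [Matrix.mul_assoc]
      _ = X := by rw [hblock, ← hX]
end

section
/- Let X be a complex n×n skew-symmetric matrix (Xᵀ = −X) with rank(X) = 2r. Then there exist a unitary matrix Q ∈ U_n and an invertible skew-symmetric matrix Ω ∈ ℂ^{2r×2r} such that for every invertible complex n×n matrix A the following are equivalent: (i) A X Aᵀ = X; (ii) writing C := Q* A Q in block form with C₁₁ the (2r)×(2r) block on the first 2r rows and columns, one has C₁₁ Ω C₁₁ᵀ = Ω and C₂₁ = 0. -/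
open Matrix

/-- The rank of a square matrix is at most its size. -/
theorem rank_eq_le_size_c {n m : ℕ} (X : Matrix (Fin n) (Fin n) ℂ) (h : X.rank = m) : m ≤ n := by
  rw [← h]; simpa using X.rank_le_card_height

/-- The column space of a complex matrix of rank `k` has an orthonormal basis, given by the columns
of an isometry `W`. -/
theorem exists_isometry_onto_column_space {n k : ℕ} (X : Matrix (Fin n) (Fin n) ℂ)
    (hrank : X.rank = k) :
    ∃ W : Matrix (Fin n) (Fin k) ℂ, Wᴴ * W = 1 ∧ W * (Wᴴ * X) = X := by
  let S : Submodule ℂ (EuclideanSpace ℂ (Fin n)) := LinearMap.range (Matrix.toEuclideanLin X)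
  have hS : Module.finrank ℂ S = k := by
    rw [← hrank, Matrix.rank_eq_finrank_range_toLin X
      (EuclideanSpace.basisFun (Fin n) ℂ).toBasis (EuclideanSpace.basisFun (Fin n) ℂ).toBasis,
      ← Matrix.toEuclideanLin_eq_toLin_orthonormal]
  let w : OrthonormalBasis (Fin k) ℂ S := (stdOrthonormalBasis ℂ S).reindex (finCongr hS)
  refine ⟨Matrix.of fun i j => (w j : EuclideanSpace ℂ (Fin n)) i, ?_, ?_⟩
  · ext a b
    have h := orthonormal_iff_ite.mp w.orthonormal a b
    rw [Submodule.coe_inner, PiLp.inner_apply] at h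
    simpa [Matrix.mul_apply, Matrix.one_apply, mul_comm] using h
  · ext i j
    have hx : WithLp.toLp 2 (X.col j) ∈ S :=
      ⟨EuclideanSpace.single j 1, by ext; simp [Matrix.toEuclideanLin]⟩
    have h := congrArg (fun x : S => (x : EuclideanSpace ℂ (Fin n)) i) (w.sum_repr' ⟨_, hx⟩)
    simp only [Submodule.coe_inner, PiLp.inner_apply, Submodule.coe_sum, Submodule.coe_smul,
      WithLp.ofLp_sum, Finset.sum_apply, PiLp.smul_apply, smul_eq_mul] at h
    simpa [Matrix.mul_apply, mul_comm] using h

/-- The columns of an isometry can be completed to those of a unitary matrix. -/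
theorem exists_unitary_extending_isometry {n k : ℕ} (hk : k ≤ n) (W : Matrix (Fin n) (Fin k) ℂ)
    (hW : Wᴴ * W = 1) :
    ∃ Q : Matrix (Fin n) (Fin n) ℂ, Qᴴ * Q = 1 ∧ Q.submatrix id (Fin.castLE hk) = W := by
  let v : Fin n → EuclideanSpace ℂ (Fin n) := fun i =>
    if h : (i : ℕ) < k then WithLp.toLp 2 (W.col ⟨i, h⟩) else 0
  have hv : Orthonormal ℂ (Set.domRestrict {i : Fin n | (i : ℕ) < k} v) := by
    rw [orthonormal_iff_ite]
    rintro ⟨a, ha⟩ ⟨b, hb⟩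
    have ha' : (a : ℕ) < k := ha
    have hb' : (b : ℕ) < k := hb
    have h := congrFun (congrFun hW ⟨a, ha'⟩) ⟨b, hb'⟩
    simpa [v, Set.domRestrict_apply, ha', hb', PiLp.inner_apply, Matrix.mul_apply, Matrix.one_apply,
      mul_comm ((starRingEnd ℂ) _), Fin.ext_iff] using h
  obtain ⟨b, hb⟩ := hv.exists_orthonormalBasis_extension_of_card_eq (by simp)
  refine ⟨Matrix.of fun i j => b j i, ?_, ?_⟩
  · ext i j
    have h := orthonormal_iff_ite.mp b.orthonormal i j
    rw [PiLp.inner_apply] at h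
    simpa [Matrix.mul_apply, Matrix.one_apply, mul_comm] using h
  · ext i j
    have h := hb (Fin.castLE hk j) (by simp)
    simp [h, v]

/-- If `E` has a left inverse `Eᵀ` and `Om` is invertible, then `C` fixes `E * Om * Eᵀ` under
congruence iff it preserves the range of `E` and its compression fixes `Om`. -/
theorem congruence_fixes_iff {m n K : Type*} [Fintype m] [DecidableEq m] [Fintype n] [Field K]
    (E : Matrix n m K) (hE : Eᵀ * E = 1) (Om : Matrix m m K) (hOm : IsUnit Om)
    (C : Matrix n n K) :
    C * (E * Om * Eᵀ) * Cᵀ = E * Om * Eᵀ ↔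
      (Eᵀ * C * E) * Om * (Eᵀ * C * E)ᵀ = Om ∧ C * E = E * (Eᵀ * C * E) := by
  constructor
  · intro h
    have hright : C * E * (Om * (Eᵀ * C * E)ᵀ) = E * Om := by
      have := congrArg (· * E) h
      simpa only [transpose_mul, transpose_transpose, Matrix.mul_assoc, hE, Matrix.mul_one]
        using this
    have hfix : (Eᵀ * C * E) * Om * (Eᵀ * C * E)ᵀ = Om := by
      have := congrArg (Eᵀ * ·) hright
      simpa only [← Matrix.mul_assoc, hE, Matrix.one_mul] using this
    refine ⟨hfix, ?_⟩
    have hdet : IsUnit (Om * (Eᵀ * C * E)ᵀ).det := by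
      have h1 := (Matrix.isUnit_iff_isUnit_det _).mp hOm
      rw [← hfix, Matrix.mul_assoc, det_mul] at h1
      exact isUnit_of_mul_isUnit_right h1
    have heq : C * E * (Om * (Eᵀ * C * E)ᵀ) = E * (Eᵀ * C * E) * (Om * (Eᵀ * C * E)ᵀ) := by
      rw [hright, Matrix.mul_assoc E, ← Matrix.mul_assoc _ Om, hfix]
    have := congrArg (· * (Om * (Eᵀ * C * E)ᵀ)⁻¹) heq
    simpa only [Matrix.mul_nonsing_inv_cancel_right _ _ hdet] using this
  · rintro ⟨hfix, hinv⟩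
    calc C * (E * Om * Eᵀ) * Cᵀ = (C * E) * Om * (C * E)ᵀ := by
          simp only [transpose_mul, Matrix.mul_assoc]
      _ = E * ((Eᵀ * C * E) * Om * (Eᵀ * C * E)ᵀ) * Eᵀ := by
          rw [hinv, transpose_mul E]; simp only [Matrix.mul_assoc]
      _ = E * Om * Eᵀ := by rw [hfix]

theorem stabilizer_congruence_skew_complex (n r : ℕ) (X : Matrix (Fin n) (Fin n) ℂ)
    (hskew : Xᵀ = -X) (hrank : X.rank = 2 * r) :
    ∃ (Q : Matrix (Fin n) (Fin n) ℂ) (Om : Matrix (Fin (2 * r)) (Fin (2 * r)) ℂ),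
      Qᴴ * Q = 1 ∧ Omᵀ = -Om ∧ IsUnit Om ∧
      ∀ A : Matrix (Fin n) (Fin n) ℂ, IsUnit A →
        (A * X * Aᵀ = X ↔
          ((Qᴴ * A * Q).submatrix (Fin.castLE (rank_eq_le_size_c X hrank))
              (Fin.castLE (rank_eq_le_size_c X hrank)) * Om *
            ((Qᴴ * A * Q).submatrix (Fin.castLE (rank_eq_le_size_c X hrank))
              (Fin.castLE (rank_eq_le_size_c X hrank)))ᵀ = Om ∧
           ∀ i j : Fin n, 2 * r ≤ (i : ℕ) → (j : ℕ) < 2 * r → (Qᴴ * A * Q) i j = 0)) := by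
  obtain ⟨W, hW, hWX⟩ := exists_isometry_onto_column_space X hrank
  have hk := rank_eq_le_size_c X hrank
  obtain ⟨Q, hQ, hQW⟩ := exists_unitary_extending_isometry hk W hW
  have hQ' : Q * Qᴴ = 1 := mul_eq_one_comm.mp hQ
  have hQt : Qᴴᵀ * Qᵀ = 1 := by rw [← transpose_mul, hQ', transpose_one]
  have hQt' : Qᵀ * Qᴴᵀ = 1 := by rw [← transpose_mul, hQ, transpose_one]
  let E : Matrix (Fin n) (Fin (2 * r)) ℂ := (1 : Matrix _ _ ℂ).submatrix id (Fin.castLE hk)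
  have hmulE (C : Matrix (Fin n) (Fin n) ℂ) : C * E = C.submatrix id (Fin.castLE hk) := by
    ext i j; simp [E, Matrix.mul_apply, Matrix.one_apply]
  have hEmulE (C : Matrix (Fin n) (Fin n) ℂ) :
      Eᵀ * C * E = C.submatrix (Fin.castLE hk) (Fin.castLE hk) := by
    rw [Matrix.mul_assoc, hmulE]
    ext i j; simp [E, Matrix.mul_apply, Matrix.one_apply]
  have hE : Eᵀ * E = 1 := by
    have := hEmulE 1
    rw [Matrix.mul_one] at this
    rw [this, submatrix_one _ (Fin.castLE_injective hk)]
  have hQE : Q * E = W := (hmulE Q).trans hQW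
  have hXW : X * (Wᴴᵀ * Wᵀ) = X := by
    have := congrArg transpose hWX
    simp only [transpose_mul, hskew, Matrix.neg_mul, Matrix.mul_assoc, neg_inj] at this
    exact this
  let Om := Wᴴ * X * Wᴴᵀ
  have hX : W * Om * Wᵀ = X := by
    calc W * Om * Wᵀ = (W * (Wᴴ * X)) * (Wᴴᵀ * Wᵀ) := by simp only [Om, Matrix.mul_assoc]
      _ = X := by rw [hWX, hXW]
  have hOm : IsUnit Om := by
    have h1 : X.rank ≤ Om.rank := by
      rw [← hX]
      exact (Matrix.rank_mul_le_left _ _).trans (Matrix.rank_mul_le_right _ _)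
    rw [hrank] at h1
    rw [← Matrix.mulVec_surjective_iff_isUnit, ← Matrix.coe_mulVecLin, ← LinearMap.range_eq_top]
    refine Submodule.eq_top_of_finrank_eq (le_antisymm (Submodule.finrank_le _) ?_)
    simpa [Matrix.rank] using h1
  have hXE : X = Q * (E * Om * Eᵀ) * Qᵀ := by
    conv_lhs => rw [← hX, ← hQE, transpose_mul]
    simp only [Matrix.mul_assoc]
  have hconj (M : Matrix (Fin n) (Fin n) ℂ) : Qᴴ * (Q * M * Qᵀ) * Qᴴᵀ = M := by
    rw [Matrix.mul_assoc, Matrix.mul_assoc, hQt', Matrix.mul_one, ← Matrix.mul_assoc, hQ,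
      Matrix.one_mul]
  refine ⟨Q, Om, hQ, ?_, hOm, fun A _ => ?_⟩
  · simp only [Om, transpose_mul, transpose_transpose, hskew, Matrix.mul_assoc, Matrix.neg_mul,
      Matrix.mul_neg]
  have hact : A * X * Aᵀ = Q * ((Qᴴ * A * Q) * (E * Om * Eᵀ) * (Qᴴ * A * Q)ᵀ) * Qᵀ := by
    calc A * X * Aᵀ = (Q * Qᴴ) * A * X * Aᵀ * (Qᴴᵀ * Qᵀ) := by
          rw [hQ', hQt, Matrix.one_mul, Matrix.mul_one]
      _ = _ := by
          rw [hXE]; simp only [transpose_mul, Matrix.mul_assoc]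
  have hiff : A * X * Aᵀ = X ↔
      (Qᴴ * A * Q) * (E * Om * Eᵀ) * (Qᴴ * A * Q)ᵀ = E * Om * Eᵀ := by
    rw [hact]
    constructor
    · intro h
      rw [← hconj ((Qᴴ * A * Q) * (E * Om * Eᵀ) * (Qᴴ * A * Q)ᵀ), h]
      conv_lhs => rw [hXE]
      exact hconj _
    · intro h
      rw [h, ← hXE]
  rw [hiff, congruence_fixes_iff E hE Om hOm, hEmulE, hmulE]
  refine and_congr_right fun _ => ?_
  generalize Qᴴ * A * Q = C
  constructor
  · intro h i j hi hj
    have := congrFun (congrFun h i) ⟨j, hj⟩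
    have hne (x : Fin (2 * r)) : i ≠ Fin.castLE hk x := fun hx => by
      have := congrArg Fin.val hx
      simp at this; omega
    simpa [E, Matrix.mul_apply, Matrix.one_apply, hne] using this
  · intro h
    ext i j
    by_cases hi : (i : ℕ) < 2 * r
    · obtain ⟨i, rfl⟩ : ∃ i' : Fin (2 * r), i = Fin.castLE hk i' := ⟨⟨i, hi⟩, rfl⟩
      simp [E, Matrix.mul_apply, Matrix.one_apply]
    · have hne (x : Fin (2 * r)) : i ≠ Fin.castLE hk x := fun hx => by
        have := congrArg Fin.val hx
        simp at this; omega
      simp [E, Matrix.mul_apply, hne, h i (Fin.castLE hk j) (by omega)]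
end

section
/- Let X be a real n×n symmetric matrix (Xᵀ = X) with rank(X) = r. Then there exist an orthogonal matrix Q ∈ O_n(ℝ) and an invertible symmetric matrix B ∈ ℝ^{r×r} such that for every invertible real n×n matrix A the following are equivalent: (i) A X Aᵀ = X; (ii) writing C := Qᵀ A Q in block form with C₁₁ the r×r block on the first r rows and columns, one has C₁₁ B C₁₁ᵀ = B and C₂₁ = 0. -/
open Matrix

/-- The rank of a square matrix is at most its size. -/
theorem rank_eq_le_size_r {n m : ℕ} (X : Matrix (Fin n) (Fin n) ℝ) (h : X.rank = m) : m ≤ n := by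
  rw [← h]; simpa using X.rank_le_card_height

/-- If `E` has orthonormal columns and `B` is invertible, then `C` stabilizes `E * B * Eᵀ` under
congruence iff `C` maps the range of `E` to itself and its compression stabilizes `B`. -/
theorem congruence_stabilizes_iff {m k R : Type*} [Fintype m] [Fintype k]
    [DecidableEq k] [CommRing R] {E : Matrix m k R} (hE : Eᵀ * E = 1) {B : Matrix k k R}
    (hB : IsUnit B) (C : Matrix m m R) :
    C * (E * B * Eᵀ) * Cᵀ = E * B * Eᵀ ↔
      (Eᵀ * C * E) * B * (Eᵀ * C * E)ᵀ = B ∧ C * E = E * (Eᵀ * C * E) := by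
  constructor
  · intro h
    have hcol : C * E * (B * (Eᵀ * C * E)ᵀ) = E * B := by
      have := congrArg (· * E) h
      simpa [Matrix.mul_assoc, hE] using this
    have hcomp : (Eᵀ * C * E) * B * (Eᵀ * C * E)ᵀ = B := by
      have := congrArg (Eᵀ * ·) hcol
      simp only [← Matrix.mul_assoc, hE, Matrix.one_mul] at this
      simpa [Matrix.mul_assoc] using this
    refine ⟨hcomp, ?_⟩
    have hunit : IsUnit (B * (Eᵀ * C * E)ᵀ) := by
      rw [Matrix.isUnit_iff_isUnit_det] at hB ⊢
      have hdet := congrArg Matrix.det hcomp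
      rw [Matrix.mul_assoc, Matrix.det_mul] at hdet
      exact isUnit_of_mul_isUnit_right (hdet ▸ hB)
    obtain ⟨V, hV⟩ := hunit.exists_right_inv
    have hmul : C * E * (B * (Eᵀ * C * E)ᵀ) =
        E * (Eᵀ * C * E) * (B * (Eᵀ * C * E)ᵀ) := by
      rw [hcol, Matrix.mul_assoc E, ← Matrix.mul_assoc _ B, hcomp]
    have := congrArg (· * V) hmul
    simpa only [Matrix.mul_assoc _ (B * (Eᵀ * C * E)ᵀ) V, hV, Matrix.mul_one] using this
  · rintro ⟨hcomp, hinv⟩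
    calc C * (E * B * Eᵀ) * Cᵀ = (C * E) * B * (C * E)ᵀ := by
          simp only [Matrix.transpose_mul, Matrix.mul_assoc]
      _ = E * ((Eᵀ * C * E) * B * (Eᵀ * C * E)ᵀ) * Eᵀ := by
          rw [hinv, Matrix.transpose_mul E]
          simp only [Matrix.mul_assoc]
      _ = E * B * Eᵀ := by rw [hcomp]

/-- A real symmetric matrix is orthogonally diagonalizable with the nonzero eigenvalues listed
first. -/
theorem exists_orthogonal_diagonalization_nonzero_first {n r : ℕ} {X : Matrix (Fin n) (Fin n) ℝ}
    (hsymm : Xᵀ = X) (hrank : X.rank = r) :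
    ∃ (Q : Matrix (Fin n) (Fin n) ℝ) (d : Fin n → ℝ),
      Qᵀ * Q = 1 ∧ X = Q * diagonal d * Qᵀ ∧ ∀ i, d i ≠ 0 ↔ (i : ℕ) < r := by
  have hX : X.IsHermitian := by rwa [Matrix.IsHermitian, conjTranspose_eq_transpose_of_trivial]
  have hr : r ≤ n := rank_eq_le_size_r X hrank
  have hcard : Fintype.card {i : Fin n // (i : ℕ) < r} =
      Fintype.card {i // hX.eigenvalues i ≠ 0} := by
    rw [← hX.rank_eq_card_non_zero_eigs, hrank, Fintype.card_subtype, Fin.card_filter_val_lt, min_eq_right hr]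
  let e := Fintype.equivOfCardEq hcard
  let σ : Equiv.Perm (Fin n) := e.extendSubtype
  have hU : (hX.eigenvectorUnitary : Matrix (Fin n) (Fin n) ℝ)ᵀ * hX.eigenvectorUnitary = 1 := by
    simpa [star_eq_conjTranspose] using Unitary.coe_star_mul_self hX.eigenvectorUnitary
  refine ⟨(hX.eigenvectorUnitary : Matrix (Fin n) (Fin n) ℝ).submatrix id σ,
    hX.eigenvalues ∘ σ, ?_, ?_, fun i => ?_⟩
  · rw [transpose_submatrix, ← submatrix_mul _ _ _ _ _ Function.bijective_id, hU,
      submatrix_one_equiv]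
  · rw [← submatrix_diagonal_equiv, transpose_submatrix, submatrix_mul_equiv,
      submatrix_mul_equiv, submatrix_id_id]
    conv_lhs => rw [hX.spectral_theorem, Unitary.conjStarAlgAut_apply]
    simp [star_eq_conjTranspose]
  · by_cases hi : (i : ℕ) < r
    · exact iff_of_true (e.extendSubtype_mem i hi) hi
    · exact iff_of_false (e.extendSubtype_not_mem i hi) hi

theorem stabilizer_congruence_symm_real (n r : ℕ) (X : Matrix (Fin n) (Fin n) ℝ)
    (hsymm : Xᵀ = X) (hrank : X.rank = r) :
    ∃ (Q : Matrix (Fin n) (Fin n) ℝ) (B : Matrix (Fin r) (Fin r) ℝ),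
      Qᵀ * Q = 1 ∧ Bᵀ = B ∧ IsUnit B ∧
      ∀ A : Matrix (Fin n) (Fin n) ℝ, IsUnit A →
        (A * X * Aᵀ = X ↔
          ((Qᵀ * A * Q).submatrix (Fin.castLE (rank_eq_le_size_r X hrank))
              (Fin.castLE (rank_eq_le_size_r X hrank)) * B *
            ((Qᵀ * A * Q).submatrix (Fin.castLE (rank_eq_le_size_r X hrank))
              (Fin.castLE (rank_eq_le_size_r X hrank)))ᵀ = B ∧
           ∀ i j : Fin n, r ≤ (i : ℕ) → (j : ℕ) < r → (Qᵀ * A * Q) i j = 0)) := by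
  obtain ⟨Q, d, hQ, hXd, hd⟩ := exists_orthogonal_diagonalization_nonzero_first hsymm hrank
  have hQ' : Q * Qᵀ = 1 := mul_eq_one_comm.mp hQ
  have hr : r ≤ n := rank_eq_le_size_r X hrank
  let E : Matrix (Fin n) (Fin r) ℝ := (1 : Matrix (Fin n) (Fin n) ℝ).submatrix id (Fin.castLE hr)
  let B : Matrix (Fin r) (Fin r) ℝ := diagonal (d ∘ Fin.castLE hr)
  have hmulE (M : Matrix (Fin n) (Fin n) ℝ) : M * E = M.submatrix id (Fin.castLE hr) := by
    ext i j
    simp [E, Matrix.mul_apply, Matrix.one_apply]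
  have hEmul {p : Type} (M : Matrix (Fin n) p ℝ) : Eᵀ * M = M.submatrix (Fin.castLE hr) id := by
    ext i j
    simp [E, Matrix.mul_apply, Matrix.one_apply]
  have hEmul_lt {p : Type} (M : Matrix (Fin r) p ℝ) (i : Fin n) (hi : (i : ℕ) < r) (j : p) :
      (E * M) i j = M ⟨i, hi⟩ j := by
    rw [Matrix.mul_apply, Finset.sum_eq_single ⟨i, hi⟩]
    · simp [E, Matrix.one_apply]
    · intro b _ hb
      have : i ≠ Fin.castLE hr b := fun h => hb (Fin.ext (by simp [h]))
      simp [E, this]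
    · simp
  have hEmul_ge {p : Type} (M : Matrix (Fin r) p ℝ) (i : Fin n) (hi : r ≤ (i : ℕ)) (j : p) :
      (E * M) i j = 0 := by
    rw [Matrix.mul_apply]
    refine Finset.sum_eq_zero fun b _ => ?_
    have : i ≠ Fin.castLE hr b := fun h => (h ▸ hi : r ≤ (Fin.castLE hr b : ℕ)).not_gt b.isLt
    simp [E, this]
  have hE : Eᵀ * E = 1 := by
    rw [hEmul, submatrix_submatrix]
    exact submatrix_one _ (Fin.castLE_injective hr)
  have hB : IsUnit B := by
    rw [Matrix.isUnit_iff_isUnit_det, det_diagonal, isUnit_iff_ne_zero, Finset.prod_ne_zero_iff]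
    exact fun i _ => (hd _).mpr i.isLt
  have hdiag : diagonal d = E * B * Eᵀ := by
    ext i j
    rw [Matrix.mul_assoc]
    rcases lt_or_ge (i : ℕ) r with hi | hi
    · rw [hEmul_lt _ i hi]
      simp [B, E, diagonal_mul, Matrix.one_apply, diagonal_apply]
    · rw [hEmul_ge _ i hi, diagonal_apply]
      have : d i = 0 := not_not.mp fun h => absurd ((hd i).mp h) (not_lt.mpr hi)
      simp [this]
  refine ⟨Q, B, hQ, diagonal_transpose _, hB, fun A _ => ?_⟩
  set C := Qᵀ * A * Q with hC
  have hconj : A * X * Aᵀ = X ↔ C * (E * B * Eᵀ) * Cᵀ = E * B * Eᵀ := by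
    rw [← hdiag, hXd]
    have hA : A = Q * C * Qᵀ := by
      calc A = (Q * Qᵀ) * A * (Q * Qᵀ) := by simp [hQ']
        _ = Q * C * Qᵀ := by simp only [hC, Matrix.mul_assoc]
    have hcancel (M : Matrix (Fin n) (Fin n) ℝ) : Qᵀ * (Q * M) = M := by
      rw [← Matrix.mul_assoc, hQ, Matrix.one_mul]
    have hl : A * (Q * diagonal d * Qᵀ) * Aᵀ = Q * (C * diagonal d * Cᵀ) * Qᵀ := by
      rw [hA]
      simp only [transpose_mul, transpose_transpose, Matrix.mul_assoc, hcancel]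
    rw [hl]
    refine ⟨fun h => ?_, fun h => by rw [h]⟩
    have := congrArg (fun M => Qᵀ * M * Q) h
    simpa only [Matrix.mul_assoc, hcancel, hQ, Matrix.mul_one] using this
  have hcomp : Eᵀ * C * E = C.submatrix (Fin.castLE hr) (Fin.castLE hr) := by
    rw [Matrix.mul_assoc, hmulE, hEmul]
    rfl
  rw [hconj, congruence_stabilizes_iff hE hB, hcomp]
  refine and_congr_right fun _ => ⟨fun h i j hi hj => ?_, fun h => ?_⟩
  · have := congrFun (congrFun h i) ⟨j, hj⟩
    rw [hEmul_ge _ i hi, hmulE] at this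
    exact this
  · ext i j
    rw [hmulE]
    rcases lt_or_ge (i : ℕ) r with hi | hi
    · rw [hEmul_lt _ i hi]
      rfl
    · rw [hEmul_ge _ i hi]
      exact h i _ hi j.isLt
end

section
/- Let X be a complex n×n symmetric matrix (Xᵀ = X) with rank(X) = r. Then there exist a unitary matrix Q ∈ U_n and an invertible symmetric matrix B ∈ ℂ^{r×r} such that for every invertible complex n×n matrix A the following are equivalent: (i) A X Aᵀ = X; (ii) writing C := Q* A Q in block form with C₁₁ the r×r block on the first r rows and columns, one has C₁₁ B C₁₁ᵀ = B and C₂₁ = 0. -/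
open Matrix

/-- The rank of a square matrix is at most its size. -/
theorem rank_eq_le_size_c' {n m : ℕ} (X : Matrix (Fin n) (Fin n) ℂ) (h : X.rank = m) : m ≤ n := by
  rw [← h]; simpa using X.rank_le_card_height

section Auxiliary

variable {m k : Type*} [Fintype m] [Fintype k] [DecidableEq m]

/-- A square matrix over a field with full rank is invertible. -/
theorem Matrix.isUnit_of_rank_eq_card {K : Type*} [Field K] (B : Matrix m m K)
    (h : B.rank = Fintype.card m) : IsUnit B := by
  rw [← linearIndependent_cols_iff_isUnit, linearIndependent_iff_card_eq_finrank_span, ← h,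
    rank_eq_finrank_span_cols]
  rfl

theorem Matrix.rank_fromBlocks_zero_le {K : Type*} [Field K] (B : Matrix m m K) :
    (fromBlocks B 0 0 0 : Matrix (m ⊕ k) (m ⊕ k) K).rank ≤ B.rank := by
  have h : (fromBlocks B 0 0 0 : Matrix (m ⊕ k) (m ⊕ k) K) =
      fromRows (1 : Matrix m m K) 0 * (B * fromCols (1 : Matrix m m K) 0) := by
    ext (i | i) (j | j) <;> simp [mul_fromCols, fromRows_mul]
  rw [h]
  exact (rank_mul_le_right _ _).trans (rank_mul_le_left _ _)

/-- The first block of columns of some unitary matrix is an orthonormal basis of the column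
space of `X`, so that the other columns are orthogonal to it. -/
theorem Matrix.exists_unitary_conjTranspose_mul_apply_inr_eq_zero [DecidableEq k]
    (X : Matrix (m ⊕ k) (m ⊕ k) ℂ)
    (hr : X.rank = Fintype.card m) :
    ∃ Q : Matrix (m ⊕ k) (m ⊕ k) ℂ, Qᴴ * Q = 1 ∧ ∀ i j, (Qᴴ * X) (.inr i) j = 0 := by
  let V : Submodule ℂ (EuclideanSpace ℂ (m ⊕ k)) :=
    Submodule.span ℂ (Set.range fun j => WithLp.toLp 2 (X.col j))
  have hV : Module.finrank ℂ V = Fintype.card m := by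
    rw [← hr, rank_eq_finrank_span_cols]
    have : V = (Submodule.span ℂ (Set.range X.col)).map
        (WithLp.linearEquiv 2 ℂ (m ⊕ k → ℂ)).symm.toLinearMap := by
      rw [Submodule.map_span, ← Set.range_comp]
      rfl
    rw [this]
    exact LinearEquiv.finrank_map_eq _ _
  let e : OrthonormalBasis m ℂ V :=
    (stdOrthonormalBasis ℂ V).reindex (Fintype.equivOfCardEq (by simp [hV]))
  let v : m ⊕ k → EuclideanSpace ℂ (m ⊕ k) := Sum.elim (fun i => (e i : _)) 0
  have hv : Orthonormal ℂ ((Set.range Sum.inl).domRestrict v) := by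
    have he : Orthonormal ℂ (fun i => (e i : EuclideanSpace ℂ (m ⊕ k))) :=
      e.orthonormal.comp_linearIsometry V.subtypeₗᵢ
    have := he.comp (Equiv.ofInjective _ (Sum.inl_injective (α := m) (β := k))).symm
      (Equiv.injective _)
    convert this using 1
    ext ⟨_, i, rfl⟩ : 1
    simp [v]
  obtain ⟨b, hb⟩ := hv.exists_orthonormalBasis_extension_of_card_eq (by simp)
  refine ⟨of fun i j => b j i, ?_, fun i j => ?_⟩
  · ext i j
    have := b.inner_eq_ite i j
    rw [EuclideanSpace.inner_eq_star_dotProduct, dotProduct_comm] at this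
    rw [one_apply, ← this]
    rfl
  · have hmem : WithLp.toLp 2 (X.col j) ∈ V := Submodule.subset_span ⟨j, rfl⟩
    have hsum := congrArg Subtype.val (e.sum_repr ⟨_, hmem⟩)
    have hb' : ∀ l, (e l : EuclideanSpace ℂ (m ⊕ k)) = b (.inl l) := fun l => by
      rw [hb _ ⟨l, rfl⟩]; rfl
    have h0 : inner ℂ (b (.inr i)) (WithLp.toLp 2 (X.col j)) = 0 := by
      rw [← show _ = WithLp.toLp 2 (X.col j) from hsum]
      simp [hb', b.inner_eq_ite]
    rw [EuclideanSpace.inner_eq_star_dotProduct, dotProduct_comm] at h0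
    exact h0

/-- A symmetric matrix of rank `r` is unitarily congruent to an invertible symmetric `r × r` block
padded by zeros. -/
theorem Matrix.exists_unitary_congruence_fromBlocks [DecidableEq k]
    (X : Matrix (m ⊕ k) (m ⊕ k) ℂ) (hX : Xᵀ = X)
    (hr : X.rank = Fintype.card m) :
    ∃ (Q : Matrix (m ⊕ k) (m ⊕ k) ℂ) (B : Matrix m m ℂ),
      Qᴴ * Q = 1 ∧ Bᵀ = B ∧ IsUnit B ∧ X = Q * fromBlocks B 0 0 0 * Qᵀ := by
  obtain ⟨Q, hQ, h0⟩ := exists_unitary_conjTranspose_mul_apply_inr_eq_zero X hr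
  have hQ' : Q * Qᴴ = 1 := mul_eq_one_comm.mp hQ
  have hQt : Qᴴᵀ * Qᵀ = 1 := by rw [← transpose_mul, hQ', transpose_one]
  set Y := Qᴴ * X * Qᴴᵀ with hY
  have hYt : Yᵀ = Y := by simp [hY, transpose_mul, hX, Matrix.mul_assoc]
  have hYr : ∀ i j, Y (.inr i) j = 0 := fun i j => by simp [hY, mul_apply (M := Qᴴ * X), h0]
  have hYc : ∀ i j, Y i (.inr j) = 0 := fun i j => by rw [← hYt]; exact hYr j i
  have hYB : Y = fromBlocks Y.toBlocks₁₁ 0 0 0 := by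
    ext (i | i) (j | j) <;> simp [hYr, hYc, toBlocks₁₁]
  have hXY : X = Q * Y * Qᵀ := by
    calc X = (Q * Qᴴ) * X * (Qᴴᵀ * Qᵀ) := by simp [hQ', hQt]
      _ = Q * Y * Qᵀ := by simp only [hY, Matrix.mul_assoc]
  refine ⟨Q, Y.toBlocks₁₁, hQ, ?_, ?_, by rwa [← hYB]⟩
  · ext i j
    exact congrFun₂ hYt (.inl i) (.inl j)
  · refine isUnit_of_rank_eq_card _ (le_antisymm (rank_le_card_height _) ?_)
    refine le_trans ?_ (rank_fromBlocks_zero_le (k := k) _)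
    rw [← hYB, ← hr]
    nth_rw 1 [hXY]
    exact (rank_mul_le_left _ _).trans (rank_mul_le_right _ _)

/-- The stabilizer under congruence of an invertible block padded by zeros. -/
theorem Matrix.mul_fromBlocks_mul_transpose_eq_iff {R : Type*} [CommRing R] {B : Matrix m m R}
    (hB : IsUnit B) (C : Matrix (m ⊕ k) (m ⊕ k) R) :
    C * fromBlocks B 0 0 0 * Cᵀ = fromBlocks B 0 0 0 ↔
      C.toBlocks₁₁ * B * C.toBlocks₁₁ᵀ = B ∧ C.toBlocks₂₁ = 0 := by
  rw [← fromBlocks_toBlocks C]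
  simp only [fromBlocks_transpose, fromBlocks_multiply, Matrix.mul_zero, add_zero,
    Matrix.zero_mul, fromBlocks_inj, toBlocks_fromBlocks₁₁, toBlocks_fromBlocks₂₁]
  refine ⟨fun ⟨h₁, _, h₃, _⟩ => ⟨h₁, ?_⟩, fun ⟨h₁, h₂⟩ => by simp [h₁, h₂]⟩
  have hU : IsUnit (B * C.toBlocks₁₁ᵀ) := by
    have : IsUnit (C.toBlocks₁₁ * (B * C.toBlocks₁₁ᵀ)) := by rwa [← Matrix.mul_assoc, h₁]
    rw [isUnit_iff_isUnit_det] at this ⊢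
    rw [det_mul] at this
    exact isUnit_of_mul_isUnit_right this
  rw [isUnit_iff_isUnit_det] at hU
  rw [Matrix.mul_assoc] at h₃
  rw [← mul_nonsing_inv_cancel_right _ C.toBlocks₂₁ hU, h₃, Matrix.zero_mul]

end Auxiliary

theorem stabilizer_congruence_symm_complex (n r : ℕ) (X : Matrix (Fin n) (Fin n) ℂ)
    (hsymm : Xᵀ = X) (hrank : X.rank = r) :
    ∃ (Q : Matrix (Fin n) (Fin n) ℂ) (B : Matrix (Fin r) (Fin r) ℂ),
      Qᴴ * Q = 1 ∧ Bᵀ = B ∧ IsUnit B ∧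
      ∀ A : Matrix (Fin n) (Fin n) ℂ, IsUnit A →
        (A * X * Aᵀ = X ↔
          ((Qᴴ * A * Q).submatrix (Fin.castLE (rank_eq_le_size_c' X hrank))
              (Fin.castLE (rank_eq_le_size_c' X hrank)) * B *
            ((Qᴴ * A * Q).submatrix (Fin.castLE (rank_eq_le_size_c' X hrank))
              (Fin.castLE (rank_eq_le_size_c' X hrank)))ᵀ = B ∧
           ∀ i j : Fin n, r ≤ (i : ℕ) → (j : ℕ) < r → (Qᴴ * A * Q) i j = 0)) := by
  obtain ⟨k, rfl⟩ := Nat.exists_eq_add_of_le (rank_eq_le_size_c' X hrank)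
  let φ : Fin (r + k) ≃ Fin r ⊕ Fin k := finSumFinEquiv.symm
  obtain ⟨Q, B, hQ, hBt, hB, hXQ⟩ := exists_unitary_congruence_fromBlocks
    (reindex φ φ X) (by simp [hsymm]) (by rw [rank_reindex, hrank, Fintype.card_fin])
  have hQ' : Q * Qᴴ = 1 := mul_eq_one_comm.mp hQ
  have hQt : Qᵀ * Qᴴᵀ = 1 := by rw [← transpose_mul, hQ, transpose_one]
  have hQt' : Qᴴᵀ * Qᵀ = 1 := by rw [← transpose_mul, hQ', transpose_one]
  refine ⟨Q.submatrix φ φ, B, ?_, hBt, hB, fun A _ => ?_⟩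
  · simp [conjTranspose_submatrix, submatrix_mul_equiv, hQ]
  set A' := reindex φ φ A with hA'
  set C := Qᴴ * A' * Q with hC
  have hAC : (Q.submatrix φ φ)ᴴ * A * Q.submatrix φ φ = C.submatrix φ φ := by
    have : A = A'.submatrix φ φ := by simp [hA']
    rw [this, conjTranspose_submatrix, submatrix_mul_equiv, submatrix_mul_equiv]
  have hstab : A * X * Aᵀ = X ↔
      C * fromBlocks B 0 0 0 * Cᵀ = fromBlocks B 0 0 0 := by
    have h₁ : A * X * Aᵀ = X ↔ A' * reindex φ φ X * A'ᵀ = reindex φ φ X := by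
      rw [← (reindex φ φ).injective.eq_iff]
      simp [hA', submatrix_mul_equiv]
    rw [h₁, hXQ]
    have h₂ : C * fromBlocks B 0 0 0 * Cᵀ =
        Qᴴ * (A' * (Q * fromBlocks B 0 0 0 * Qᵀ) * A'ᵀ) * Qᴴᵀ := by
      simp only [hC, transpose_mul, Matrix.mul_assoc]
    rw [h₂]
    refine ⟨fun h => ?_, fun h => ?_⟩
    · rw [h]
      calc _ = (Qᴴ * Q) * fromBlocks B 0 0 0 * (Qᵀ * Qᴴᵀ) := by simp only [Matrix.mul_assoc]
        _ = _ := by rw [hQ, hQt, Matrix.one_mul, Matrix.mul_one]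
    · generalize A' * (Q * fromBlocks B 0 0 0 * Qᵀ) * A'ᵀ = Z at h ⊢
      rw [← h]
      calc Z = (Q * Qᴴ) * Z * (Qᴴᵀ * Qᵀ) := by
            rw [hQ', hQt', Matrix.one_mul, Matrix.mul_one]
        _ = _ := by simp only [Matrix.mul_assoc]
  have h₁₁ : (C.submatrix φ φ).submatrix (Fin.castLE (rank_eq_le_size_c' X hrank))
      (Fin.castLE (rank_eq_le_size_c' X hrank)) = C.toBlocks₁₁ := by
    have hφ : ∀ i : Fin r, φ (Fin.castLE (rank_eq_le_size_c' X hrank) i) = .inl i :=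
      finSumFinEquiv_symm_apply_castAdd
    ext i j
    simp [hφ, toBlocks₁₁]
  have h₂₁ : (∀ i j : Fin (r + k), r ≤ (i : ℕ) → (j : ℕ) < r → C.submatrix φ φ i j = 0) ↔
      C.toBlocks₂₁ = 0 := by
    refine ⟨fun h => ?_, fun h i j hi hj => ?_⟩
    · ext i j
      simpa [φ, toBlocks₂₁] using h (Fin.natAdd r i) (Fin.castAdd k j) (by simp) (by simp)
    · induction i using Fin.addCases with
      | left i => exact absurd i.isLt (not_lt.mpr hi)
      | right i =>
        induction j using Fin.addCases with
        | left j => simpa [φ, toBlocks₂₁] using congrFun₂ h i j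
        | right j => simp at hj
  rw [hAC, h₁₁, h₂₁, hstab, mul_fromBlocks_mul_transpose_eq_iff hB]
end

section
/- Let G be a group acting on types V₁ and V₂, and let V₁ × V₂ carry the componentwise G-action. Let H be a subgroup of G. Then a map ε : G⧸H → V₁ × V₂ is G-equivariant and injective if and only if there exist subgroups H₁, H₂ of G with H = H₁ ∩ H₂ and injective G-equivariant maps ε₁ : G⧸H₁ → V₁ and ε₂ : G⧸H₂ → V₂ such that ε(gH) = (ε₁(gH₁), ε₂(gH₂)) for every g ∈ G. -/
theorem equivariant_embedding_into_product (G V₁ V₂ : Type*) [Group G]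
    [MulAction G V₁] [MulAction G V₂] (H : Subgroup G) (ε : G ⧸ H → V₁ × V₂) :
    ((∀ (g : G) (x : G ⧸ H), ε (g • x) = g • ε x) ∧ Function.Injective ε) ↔
      ∃ H₁ H₂ : Subgroup G, H = H₁ ⊓ H₂ ∧
        ∃ (ε₁ : G ⧸ H₁ → V₁) (ε₂ : G ⧸ H₂ → V₂),
          Function.Injective ε₁ ∧ (∀ (g : G) (x : G ⧸ H₁), ε₁ (g • x) = g • ε₁ x) ∧
          Function.Injective ε₂ ∧ (∀ (g : G) (x : G ⧸ H₂), ε₂ (g • x) = g • ε₂ x) ∧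
          ∀ g : G, ε (QuotientGroup.mk g) =
            (ε₁ (QuotientGroup.mk g), ε₂ (QuotientGroup.mk g)) := by
  constructor
  · rintro ⟨hε, hinj⟩
    have hmk (g : G) : ε (QuotientGroup.mk g) = g • ε (QuotientGroup.mk 1) := by
      rw [← hε, MulAction.Quotient.smul_mk, smul_eq_mul, mul_one]
    refine ⟨MulAction.stabilizer G (ε (QuotientGroup.mk 1)).1,
      MulAction.stabilizer G (ε (QuotientGroup.mk 1)).2, ?_,
      MulAction.ofQuotientStabilizer G _, MulAction.ofQuotientStabilizer G _,
      MulAction.injective_ofQuotientStabilizer G _,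
      MulAction.ofQuotientStabilizer_smul G _,
      MulAction.injective_ofQuotientStabilizer G _,
      MulAction.ofQuotientStabilizer_smul G _, hmk⟩
    ext g
    rw [Subgroup.mem_inf, MulAction.mem_stabilizer_iff, MulAction.mem_stabilizer_iff,
      ← Prod.smul_fst, ← Prod.smul_snd, ← Prod.ext_iff, ← hmk, hinj.eq_iff, eq_comm,
      QuotientGroup.eq, inv_one, one_mul]
  · rintro ⟨H₁, H₂, rfl, ε₁, ε₂, inj₁, hε₁, inj₂, hε₂, hmk⟩
    constructor
    · intro g x
      induction x using QuotientGroup.induction_on with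
      | H a =>
        rw [MulAction.Quotient.smul_mk, hmk, hmk, Prod.smul_mk, ← hε₁, ← hε₂,
          MulAction.Quotient.smul_mk, MulAction.Quotient.smul_mk]
    · intro x y hxy
      induction x using QuotientGroup.induction_on with
      | H a =>
        induction y using QuotientGroup.induction_on with
        | H b =>
          rw [hmk, hmk, Prod.mk.injEq, inj₁.eq_iff, inj₂.eq_iff, QuotientGroup.eq,
            QuotientGroup.eq] at hxy
          exact QuotientGroup.eq.mpr hxy
end
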